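/- Fix k ∈ ℒ and assume I − Q_{1:k−1,1:k−1} is invertible. Define w_{1:k−1,k} = (I − Q_{1:k−1,1:k−1})^{−1} Q_{1:k−1,k}, set u_L^{(k)} = (w_{1k},…,w_{k−1,k}, 1, 0,…,0)ᵀ ∈ ℝ^J, and u^{(k)} ∈ ℝ^K with ℒ-block u_L^{(k)} and ℋ-block u_H^{(k)} = −A_H^{−⊤} A_{LH}ᵀ u_L^{(k)}. For α ∈ ℝ^K let λ = (I − Pᵀ)^{−1} α and for j ∈ 𝒥 let ρ_j = Σ_{l : s(l) = j} λ_l / μ_l. Then Σ_{l∈𝒦} α_l u_l^{(k)} = Σ_{j∈𝒥} μ_j ( u_j^{(k)} − Σ_{l∈𝒦} P_{jl} u_l^{(k)} ) ρ_j. -/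

import Mathlib

open Matrix

/-- Embedding of the lowest-priority classes `ℒ = {1,…,J}` into the classes `𝒦 = {1,…,K}`. -/
def emb {K J : ℕ} (hJK : J ≤ K) (j : Fin J) : Fin K := Fin.castLE hJK j

/-- The set `ℋ = {J+1,…,K}` of higher-priority classes, as a subtype of `Fin K`. -/
abbrev Hty (K J : ℕ) := {l : Fin K // J ≤ (l : ℕ)}

/-- The matrix `B` with `B_{k,k⁺} = 1` and all other entries `0`: entry `(i, c)` is `1`
iff `c ∈ ℋ` and `i = c⁻ = prev c`. -/
def Bmat (K J : ℕ) (prev : Fin K → Fin K) : Matrix (Fin K) (Fin K) ℝ :=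
  Matrix.of fun i c => if J ≤ (c : ℕ) ∧ prev c = i then 1 else 0

/-- `A = (I - Pᵀ) diag(μ) (I - B)`. -/
noncomputable def Amat (K J : ℕ) (P : Matrix (Fin K) (Fin K) ℝ) (μ : Fin K → ℝ)
    (prev : Fin K → Fin K) : Matrix (Fin K) (Fin K) ℝ :=
  (1 - Pᵀ) * Matrix.diagonal μ * (1 - Bmat K J prev)

/-- The `(ℋ,ℋ)` block `A_H` of `A`. -/
noncomputable def AHmat (K J : ℕ) (P : Matrix (Fin K) (Fin K) ℝ) (μ : Fin K → ℝ)
    (prev : Fin K → Fin K) : Matrix (Hty K J) (Hty K J) ℝ :=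
  Matrix.of fun i j => Amat K J P μ prev i j

/-- The `(ℒ,ℋ)` block `A_{LH}` of `A`. -/
noncomputable def ALHmat {K J : ℕ} (hJK : J ≤ K) (P : Matrix (Fin K) (Fin K) ℝ)
    (μ : Fin K → ℝ) (prev : Fin K → Fin K) : Matrix (Fin J) (Hty K J) ℝ :=
  Matrix.of fun i j => Amat K J P μ prev (emb hJK i) j

/-- The `(ℋ,ℒ)` block `A_{HL}` of `A`. -/
noncomputable def AHLmat {K J : ℕ} (hJK : J ≤ K) (P : Matrix (Fin K) (Fin K) ℝ)
    (μ : Fin K → ℝ) (prev : Fin K → Fin K) : Matrix (Hty K J) (Fin J) ℝ :=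
  Matrix.of fun i j => Amat K J P μ prev i (emb hJK j)

/-- The `(ℒ,ℒ)` block `A_L` of `A`. -/
noncomputable def ALmat {K J : ℕ} (hJK : J ≤ K) (P : Matrix (Fin K) (Fin K) ℝ)
    (μ : Fin K → ℝ) (prev : Fin K → Fin K) : Matrix (Fin J) (Fin J) ℝ :=
  Matrix.of fun i j => Amat K J P μ prev (emb hJK i) (emb hJK j)

/-- `Q = P_L - P_{LH} A_H^{-⊤} A_{LH}ᵀ`. -/
noncomputable def Qmat {K J : ℕ} (hJK : J ≤ K) (P : Matrix (Fin K) (Fin K) ℝ)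
    (μ : Fin K → ℝ) (prev : Fin K → Fin K) : Matrix (Fin J) (Fin J) ℝ :=
  (Matrix.of fun i j => P (emb hJK i) (emb hJK j)) -
    (Matrix.of fun (i : Fin J) (h : Hty K J) => P (emb hJK i) h) *
      ((AHmat K J P μ prev)⁻¹)ᵀ * (ALHmat hJK P μ prev)ᵀ

/-- The principal submatrix `Q_{1:k-1,1:k-1}` (indices strictly below `k`). -/
noncomputable def Qlow {J : ℕ} (Q : Matrix (Fin J) (Fin J) ℝ) (k : Fin J) :
    Matrix {i : Fin J // i < k} {i : Fin J // i < k} ℝ :=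
  Matrix.of fun i j => Q i j

/-- `w_{1:k-1,k} = (I - Q_{1:k-1,1:k-1})⁻¹ Q_{1:k-1,k}`. -/
noncomputable def wLow {J : ℕ} (Q : Matrix (Fin J) (Fin J) ℝ) (k : Fin J) :
    {i : Fin J // i < k} → ℝ :=
  ((1 - Qlow Q k)⁻¹).mulVec fun j => Q j k

/-- `w_{jk} = Q_{jk} + Q_{j,1:k-1}(I - Q_{1:k-1,1:k-1})⁻¹ Q_{1:k-1,k}` (rows `j = k,…,J`). -/
noncomputable def wHigh {J : ℕ} (Q : Matrix (Fin J) (Fin J) ℝ) (k : Fin J) (j : Fin J) : ℝ :=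
  Q j k + ∑ l : {l : Fin J // l < k}, Q j l * wLow Q k l

/-- `u_L^{(k)} = (w_{1k},…,w_{k-1,k}, 1, 0,…,0)ᵀ ∈ ℝ^J`. -/
noncomputable def uLvec {J : ℕ} (Q : Matrix (Fin J) (Fin J) ℝ) (k : Fin J) : Fin J → ℝ :=
  fun i => if h : i < k then wLow Q k ⟨i, h⟩ else if i = k then 1 else 0

/-- `u_H^{(k)} = -A_H^{-⊤} A_{LH}ᵀ u_L^{(k)}`, for a given `ℒ`-block `uL`. -/
noncomputable def uHvec {K J : ℕ} (hJK : J ≤ K) (P : Matrix (Fin K) (Fin K) ℝ)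
    (μ : Fin K → ℝ) (prev : Fin K → Fin K) (uL : Fin J → ℝ) : Hty K J → ℝ :=
  -(((AHmat K J P μ prev)⁻¹)ᵀ.mulVec ((ALHmat hJK P μ prev)ᵀ.mulVec uL))

/-- The vector `u ∈ ℝ^K` with `ℒ`-block `uL` and `ℋ`-block `-A_H^{-⊤} A_{LH}ᵀ uL`. -/
noncomputable def uvec {K J : ℕ} (hJK : J ≤ K) (P : Matrix (Fin K) (Fin K) ℝ)
    (μ : Fin K → ℝ) (prev : Fin K → Fin K) (uL : Fin J → ℝ) : Fin K → ℝ :=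
  fun l => if h : (l : ℕ) < J then uL ⟨l, h⟩
    else uHvec hJK P μ prev uL ⟨l, Nat.le_of_not_lt h⟩

/-- A sum over all classes splits into the lowest-priority and the higher-priority classes. -/
lemma sum_emb_add_sum_Hty {K J : ℕ} (hJK : J ≤ K) (f : Fin K → ℝ) :
    ∑ l, f l = ∑ j : Fin J, f (emb hJK j) + ∑ h : Hty K J, f h := by
  have hbij : Function.Bijective
      (Sum.elim (emb hJK) Subtype.val : Fin J ⊕ Hty K J → Fin K) := by
    constructor
    · rintro (a | a) (b | b) hab
      · exact congrArg _ (Fin.castLE_injective hJK hab)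
      · have h1 : (a : ℕ) = ((b : Fin K) : ℕ) := congrArg Fin.val hab
        have h2 := b.2
        omega
      · have h1 : ((a : Fin K) : ℕ) = (b : ℕ) := congrArg Fin.val hab
        have h2 := a.2
        omega
      · exact congrArg _ (Subtype.ext hab)
    · intro l
      by_cases hl : (l : ℕ) < J
      · exact ⟨Sum.inl ⟨l, hl⟩, rfl⟩
      · exact ⟨Sum.inr ⟨l, Nat.le_of_not_lt hl⟩, rfl⟩
  rw [← hbij.sum_comp, Fintype.sum_sum_type]
  rfl

lemma uvec_emb {K J : ℕ} (hJK : J ≤ K) (P : Matrix (Fin K) (Fin K) ℝ) (μ : Fin K → ℝ)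
    (prev : Fin K → Fin K) (uL : Fin J → ℝ) (j : Fin J) :
    uvec hJK P μ prev uL (emb hJK j) = uL j := by
  simp [uvec, emb]

lemma uvec_coe_Hty {K J : ℕ} (hJK : J ≤ K) (P : Matrix (Fin K) (Fin K) ℝ) (μ : Fin K → ℝ)
    (prev : Fin K → Fin K) (uL : Fin J → ℝ) (h : Hty K J) :
    uvec hJK P μ prev uL h = uHvec hJK P μ prev uL h := by
  simp [uvec, Nat.not_lt.mpr h.2]

/-- The `ℋ`-block of `Aᵀ u` vanishes. -/
lemma transpose_Amat_mulVec_uvec {K J : ℕ} (hJK : J ≤ K) (P : Matrix (Fin K) (Fin K) ℝ)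
    (μ : Fin K → ℝ) (prev : Fin K → Fin K) (hAH : IsUnit (AHmat K J P μ prev))
    (uL : Fin J → ℝ) (h : Hty K J) :
    ((Amat K J P μ prev)ᵀ *ᵥ uvec hJK P μ prev uL) h = 0 := by
  have hblock : (ALHmat hJK P μ prev)ᵀ *ᵥ uL
      + (AHmat K J P μ prev)ᵀ *ᵥ uHvec hJK P μ prev uL = 0 := by
    have hinv : (AHmat K J P μ prev)ᵀ * ((AHmat K J P μ prev)⁻¹)ᵀ = 1 := by
      rw [← transpose_mul, nonsing_inv_mul _ ((isUnit_iff_isUnit_det _).mp hAH), transpose_one]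
    rw [uHvec, mulVec_neg, mulVec_mulVec, hinv, one_mulVec, add_neg_cancel]
  refine Eq.trans ?_ (congrFun hblock h)
  simp only [mulVec, dotProduct, Pi.add_apply]
  rw [sum_emb_add_sum_Hty hJK]
  simp only [uvec_emb, uvec_coe_Hty]
  rfl

/-- `μ_l ((I - P) u)_l` does not change when passing from `c ∈ ℋ` to the class just below it. -/
lemma mul_one_sub_mulVec_uvec_eq_prev {K J : ℕ} (hJK : J ≤ K) (P : Matrix (Fin K) (Fin K) ℝ)
    (μ : Fin K → ℝ) (prev : Fin K → Fin K) (hAH : IsUnit (AHmat K J P μ prev))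
    (uL : Fin J → ℝ) (c : Fin K) (hc : J ≤ (c : ℕ)) :
    μ c * ((1 - P) *ᵥ uvec hJK P μ prev uL) c
      = μ (prev c) * ((1 - P) *ᵥ uvec hJK P μ prev uL) (prev c) := by
  have h0 := transpose_Amat_mulVec_uvec hJK P μ prev hAH uL ⟨c, hc⟩
  rw [Amat, transpose_mul, transpose_mul, diagonal_transpose, transpose_sub, transpose_sub,
    transpose_transpose, transpose_one, ← mulVec_mulVec, ← mulVec_mulVec,
    sub_mulVec, one_mulVec, Pi.sub_apply, mulVec_diagonal, sub_eq_zero] at h0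
  rw [h0]
  simp [mulVec, dotProduct, Bmat, hc, diagonal_apply]

/-- A function that is invariant under `prev` on `ℋ` depends only on the station. -/
lemma eq_emb_of_eq_prev {K J : ℕ} (hJK : J ≤ K) (s : Fin K → Fin J) (prev : Fin K → Fin K)
    (hchain : ∀ c : Fin K, ∃ n : ℕ,
      (fun x : Fin K => if J ≤ (x : ℕ) then prev x else x)^[n] c = emb hJK (s c))
    (g : Fin K → ℝ) (hg : ∀ c : Fin K, J ≤ (c : ℕ) → g c = g (prev c)) (c : Fin K) :
    g c = g (emb hJK (s c)) := by
  obtain ⟨n, hn⟩ := hchain c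
  have hstep : ∀ x : Fin K, g (if J ≤ (x : ℕ) then prev x else x) = g x := by
    intro x
    split_ifs with hx
    · exact (hg x hx).symm
    · rfl
  have hiter : ∀ (m : ℕ) (x : Fin K),
      g ((fun x : Fin K => if J ≤ (x : ℕ) then prev x else x)^[m] x) = g x := by
    intro m
    induction m with
    | zero => intro x; rfl
    | succ m ih => intro x; rw [Function.iterate_succ_apply, ih, hstep]
  rw [← hn, hiter]

theorem stmt14 (K J : ℕ) (hJ : 1 ≤ J) (hJK : J ≤ K)
    (s : Fin K → Fin J) (prev : Fin K → Fin K)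
    (hs : ∀ j : Fin J, s (emb hJK j) = j)
    (hprev_station : ∀ c : Fin K, J ≤ (c : ℕ) → s (prev c) = s c)
    (hprev_inj : ∀ c c' : Fin K, J ≤ (c : ℕ) → J ≤ (c' : ℕ) → prev c = prev c' → c = c')
    (hchain : ∀ c : Fin K, ∃ n : ℕ,
      (fun x : Fin K => if J ≤ (x : ℕ) then prev x else x)^[n] c = emb hJK (s c))
    (P : Matrix (Fin K) (Fin K) ℝ) (hP : IsUnit (1 - P))
    (μ : Fin K → ℝ) (hμ : ∀ l, 0 < μ l)
    (hAH : IsUnit (AHmat K J P μ prev))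
    (k : Fin J)
    (hQ : IsUnit (1 - Qlow (Qmat hJK P μ prev) k))
    (α : Fin K → ℝ) :
    ∑ l : Fin K, α l * uvec hJK P μ prev (uLvec (Qmat hJK P μ prev) k) l
      = ∑ j : Fin J,
          μ (emb hJK j) *
            (uvec hJK P μ prev (uLvec (Qmat hJK P μ prev) k) (emb hJK j) -
              ∑ l : Fin K, P (emb hJK j) l *
                uvec hJK P μ prev (uLvec (Qmat hJK P μ prev) k) l) *
          (∑ l ∈ Finset.univ.filter (fun l : Fin K => s l = j),
            ((1 - Pᵀ)⁻¹.mulVec α) l / μ l) := by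
  set u := uvec hJK P μ prev (uLvec (Qmat hJK P μ prev) k)
  set lam := (1 - Pᵀ)⁻¹ *ᵥ α with hlam
  set v := (1 - P) *ᵥ u with hv
  have hstation : ∀ l, μ l * v l = μ (emb hJK (s l)) * v (emb hJK (s l)) :=
    eq_emb_of_eq_prev hJK s prev hchain (fun l => μ l * v l)
      (mul_one_sub_mulVec_uvec_eq_prev hJK P μ prev hAH _)
  have hv_apply : ∀ l, v l = u l - ∑ m, P l m * u m := by
    intro l
    rw [hv, sub_mulVec, one_mulVec]
    rfl
  have hα : α = (1 - P)ᵀ *ᵥ lam := by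
    have hdet : IsUnit (1 - Pᵀ).det := by
      rw [← transpose_one, ← transpose_sub, det_transpose]
      exact (isUnit_iff_isUnit_det _).mp hP
    rw [hlam, transpose_sub, transpose_one, mulVec_mulVec, mul_nonsing_inv _ hdet, one_mulVec]
  have hdot : ∑ l, α l * u l = ∑ l, lam l * v l := by
    change α ⬝ᵥ u = lam ⬝ᵥ v
    rw [hα, mulVec_transpose, hv, dotProduct_mulVec]
  simp only [← hv_apply]
  rw [hdot, ← Finset.sum_fiberwise Finset.univ s]
  refine Finset.sum_congr rfl fun j _ => ?_
  rw [Finset.mul_sum]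
  refine Finset.sum_congr rfl fun l hl => ?_
  rw [← (Finset.mem_filter.mp hl).2, ← hstation l]
  have := (hμ l).ne'
  field_simp
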